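/- Let H⊂ℂ² be the Heisenberg group hypersurface {y₂=|z₁|²} and H⁻={y₂<|z₁|²}. There exists a smooth function f(z₁,x₂) such that for every ζ₀∈H and every open subset U of the closure of H⁻ containing ζ₀, the (0,1)-form f(z₁,x₂)dz̄₁ on H extends to a ∂̄-closed smooth (0,1)-form ω on U, for which the equation ∂̄A = Aω admits no C¹ solution A with A(ζ₀)≠0 on H∩U₀, for any neighborhood U₀ of ζ₀ in the closure of H⁻. -/

import Mathlib

open MeasureTheory Complex Topology

noncomputable section

/-- The Heisenberg group hypersurface `H = {y₂ = |z₁|²} ⊂ ℂ²`. -/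
def Heis : Set (ℂ × ℂ) := {p | p.2.im = Complex.normSq p.1}

/-- The side `H⁻ = {y₂ < |z₁|²}`. -/
def HeisMinus : Set (ℂ × ℂ) := {p | p.2.im < Complex.normSq p.1}

/-- A relatively open subset of `X`. -/
def RelOpenIn2 (U X : Set (ℂ × ℂ)) : Prop :=
  U ⊆ X ∧ ∃ V : Set (ℂ × ℂ), IsOpen V ∧ U = V ∩ X

/-- Wirtinger derivative `∂/∂z̄₁` on `ℂ²`. -/
def dbar1 (f : ℂ × ℂ → ℂ) (p : ℂ × ℂ) : ℂ :=
  (fderiv ℝ f p (1, 0) + Complex.I * fderiv ℝ f p (Complex.I, 0)) / 2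

/-- Wirtinger derivative `∂/∂z̄₂` on `ℂ²`. -/
def dbar2 (f : ℂ × ℂ → ℂ) (p : ℂ × ℂ) : ℂ :=
  (fderiv ℝ f p (0, 1) + Complex.I * fderiv ℝ f p (0, Complex.I)) / 2

/-- The tangential Cauchy–Riemann derivative `L A` along the `(0,1)` tangent vector
`L = ∂/∂z̄₁ - 2i z₁ ∂/∂z̄₂` of `H`, computed within the set `S` (via real directional
derivatives along the tangent vectors `v = (1, 2i z̄₁)` and `iv`). -/
def tangCR (S : Set (ℂ × ℂ)) (A : ℂ × ℂ → ℂ) (p : ℂ × ℂ) : ℂ :=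
  (fderivWithin ℝ A S p (1, 2 * Complex.I * (starRingEnd ℂ p.1))
    + Complex.I * fderivWithin ℝ A S p (Complex.I, -2 * (starRingEnd ℂ p.1))) / 2


def Lop (g : ℂ × ℝ → ℂ) (p : ℂ × ℝ) : ℂ :=
  (fderiv ℝ g p (1, 2 * p.1.im) + I * fderiv ℝ g p (I, -2 * p.1.re)) / 2

def zeta (p : ℂ × ℝ) : ℂ := p.2 + I * (normSq p.1 : ℝ)

def Hf (l : ℝ) (w : ℂ) : ℂ := cexp (l * (I * w - w ^ 2))

def Hd (l : ℝ) (w : ℂ) : ℂ := l * (I - 2 * w) * Hf l w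

def rad (k : ℕ) : ℝ := 1 / ((k : ℝ) + 4)

lemma rad_pos (k : ℕ) : 0 < rad k := by unfold rad; positivity

lemma rad_le (k : ℕ) : rad k ≤ 1 / 4 := by
  unfold rad
  apply one_div_le_one_div_of_le (by norm_num)
  have : (0 : ℝ) ≤ k := Nat.cast_nonneg k
  linarith

def chi (k : ℕ) : ContDiffBump (0 : ℝ) := ⟨rad k, 2 * rad k, rad_pos k, by linarith [rad_pos k]⟩

def etaC (k : ℕ) (p : ℂ × ℝ) : ℂ := ((chi k p.2 * chi k (normSq p.1) : ℝ) : ℂ)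

def phiT (k : ℕ) (l : ℝ) (p : ℂ × ℝ) : ℂ := etaC k p * Hd l (zeta p)

lemma contDiff_normSq {n : WithTop ℕ∞} : ContDiff ℝ n (fun z : ℂ => normSq z) := by
  have : (fun z : ℂ => normSq z) = fun z => reCLM z * reCLM z + imCLM z * imCLM z := by
    funext z; simp [normSq_apply]
  rw [this]
  fun_prop

lemma contDiff_zeta {n : WithTop ℕ∞} : ContDiff ℝ n zeta := by
  have h : zeta = fun p => ofRealCLM p.2 + I * ofRealCLM (normSq p.1) := by
    funext p; simp [zeta]
  rw [h]
  have := (contDiff_normSq (n := n)).comp (contDiff_fst (𝕜 := ℝ) (E := ℂ) (F := ℝ))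
  have h2 : ContDiff ℝ n (fun p : ℂ × ℝ => ofRealCLM (normSq p.1)) :=
    ofRealCLM.contDiff.comp this
  have h3 : ContDiff ℝ n (fun p : ℂ × ℝ => ofRealCLM p.2) :=
    ofRealCLM.contDiff.comp contDiff_snd
  exact h3.add (contDiff_const.mul h2)

lemma contDiff_etaC (k : ℕ) : ContDiff ℝ 1 (etaC k) := by
  have h1 : ContDiff ℝ 1 (fun p : ℂ × ℝ => chi k p.2) := (chi k).contDiff.comp contDiff_snd
  have h2 : ContDiff ℝ 1 (fun p : ℂ × ℝ => chi k (normSq p.1)) :=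
    (chi k).contDiff.comp ((contDiff_normSq (n := 1)).comp contDiff_fst)
  exact ofRealCLM.contDiff.comp (h1.mul h2)

lemma differentiable_Hd (l : ℝ) : Differentiable ℂ (Hd l) := by
  unfold Hd Hf; fun_prop

lemma contDiff_Hd (l : ℝ) {n : WithTop ℕ∞} : ContDiff ℝ n (Hd l) := by
  have : ContDiff ℂ n (Hd l) := (differentiable_Hd l).contDiff
  exact this.restrict_scalars ℝ

lemma contDiff_phiT (k : ℕ) (l : ℝ) : ContDiff ℝ 1 (phiT k l) :=
  (contDiff_etaC k).mul ((contDiff_Hd l).comp contDiff_zeta)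

def KK (k : ℕ) : Set (ℂ × ℝ) := {p | |p.2| ≤ 2 * rad k ∧ normSq p.1 ≤ 2 * rad k}

lemma isClosed_KK (k : ℕ) : IsClosed (KK k) := by
  apply IsClosed.inter
  · exact isClosed_le (continuous_abs.comp continuous_snd) continuous_const
  · exact isClosed_le (continuous_normSq.comp continuous_fst) continuous_const

lemma isCompact_KK (k : ℕ) : IsCompact (KK k) := by
  apply Metric.isCompact_of_isClosed_isBounded (isClosed_KK k)
  apply (Metric.isBounded_closedBall (x := (0 : ℂ × ℝ)) (r := 1)).subset
  rintro ⟨z, x⟩ ⟨h1, h2⟩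
  have hr := rad_le k
  simp only at h1 h2
  rw [mem_closedBall_zero_iff, Prod.norm_def, max_le_iff]
  constructor
  · rw [normSq_eq_norm_sq] at h2
    simp only
    nlinarith [norm_nonneg z]
  · simp only [Real.norm_eq_abs]; linarith

lemma etaC_zero {k : ℕ} {p : ℂ × ℝ} (hp : p ∉ KK k) : etaC k p = 0 := by
  simp only [KK, Set.mem_ofPred_eq, not_and_or, not_le] at hp
  unfold etaC
  rcases hp with h | h
  · rw [(chi k).zero_of_le_dist (x := p.2)]
    · simp
    · simp only [chi, dist_zero_right, Real.norm_eq_abs]; exact h.le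
  · rw [(chi k).zero_of_le_dist (x := normSq p.1)]
    · simp
    · simp only [chi, dist_zero_right, Real.norm_eq_abs]
      exact h.le.trans (le_abs_self _)

lemma etaC_ev_zero {k : ℕ} {p : ℂ × ℝ} (hp : p ∉ KK k) : etaC k =ᶠ[𝓝 p] 0 := by
  filter_upwards [(isClosed_KK k).isOpen_compl.mem_nhds hp] with q hq
  exact etaC_zero hq

lemma etaC_ev_one {k : ℕ} {p : ℂ × ℝ} (h1 : |p.2| < rad k) (h2 : normSq p.1 < rad k) :
    etaC k =ᶠ[𝓝 p] 1 := by
  have o1 : IsOpen {p : ℂ × ℝ | |p.2| < rad k} := isOpen_lt (by fun_prop) continuous_const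
  have o2 : IsOpen {p : ℂ × ℝ | normSq p.1 < rad k} :=
    isOpen_lt (continuous_normSq.comp continuous_fst) continuous_const
  filter_upwards [o1.mem_nhds h1, o2.mem_nhds h2] with q hq1 hq2
  unfold etaC
  rw [(chi k).one_of_mem_closedBall (x := q.2), (chi k).one_of_mem_closedBall (x := normSq q.1)]
  · simp
  · simp only [chi, Metric.mem_closedBall, dist_zero_right, Real.norm_eq_abs]
    rw [abs_of_nonneg (normSq_nonneg _)]; exact le_of_lt hq2
  · simp only [chi, Metric.mem_closedBall, dist_zero_right, Real.norm_eq_abs]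
    exact le_of_lt hq1

lemma Lop_congr {g h : ℂ × ℝ → ℂ} {p : ℂ × ℝ} (H : g =ᶠ[𝓝 p] h) : Lop g p = Lop h p := by
  unfold Lop; rw [H.fderiv_eq]

lemma Lop_zero (p : ℂ × ℝ) : Lop 0 p = 0 := by
  simp [Lop]

lemma Lop_one (p : ℂ × ℝ) : Lop 1 p = 0 := by
  simp [Lop]

lemma Lop_mul {g h : ℂ × ℝ → ℂ} {p : ℂ × ℝ} (hg : DifferentiableAt ℝ g p)
    (hh : DifferentiableAt ℝ h p) :
    Lop (fun q => g q * h q) p = g p * Lop h p + h p * Lop g p := by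
  unfold Lop
  rw [fderiv_fun_mul hg hh]
  simp
  ring

lemma hasFDerivAt_normSq (z : ℂ) :
    HasFDerivAt (fun z : ℂ => normSq z) ((2 * z.re) • reCLM + (2 * z.im) • imCLM) z := by
  have : (fun z : ℂ => normSq z) = fun z => reCLM z * reCLM z + imCLM z * imCLM z := by
    funext z; simp [normSq_apply]
  rw [this]
  have h1 := (reCLM.hasFDerivAt (x := z)).mul (reCLM.hasFDerivAt (x := z))
  have h2 := (imCLM.hasFDerivAt (x := z)).mul (imCLM.hasFDerivAt (x := z))
  refine (h1.add h2).congr_fderiv ?_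
  refine ContinuousLinearMap.ext fun v => ?_
  simp
  ring

lemma hasFDerivAt_zeta (p : ℂ × ℝ) :
    HasFDerivAt zeta (ofRealCLM.comp (ContinuousLinearMap.snd ℝ ℂ ℝ) +
      I • ofRealCLM.comp (((2 * p.1.re) • reCLM + (2 * p.1.im) • imCLM).comp
        (ContinuousLinearMap.fst ℝ ℂ ℝ))) p := by
  have h : zeta = fun p => ofRealCLM p.2 + I * ofRealCLM (normSq p.1) := by
    funext p; simp [zeta]
  rw [h]
  have h1 : HasFDerivAt (fun p : ℂ × ℝ => ofRealCLM p.2) _ p :=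
    (ofRealCLM.hasFDerivAt).comp p (hasFDerivAt_snd (𝕜 := ℝ))
  have h2 : HasFDerivAt (fun p : ℂ × ℝ => ofRealCLM (normSq p.1)) _ p :=
    (ofRealCLM.hasFDerivAt).comp p ((hasFDerivAt_normSq p.1).comp p (hasFDerivAt_fst (𝕜 := ℝ)))
  exact h1.add (h2.const_mul I)

lemma Lop_Hd (l : ℝ) (p : ℂ × ℝ) : Lop (fun q => Hd l (zeta q)) p = 0 := by
  have h1 := ((differentiable_Hd l (zeta p)).hasDerivAt.hasFDerivAt.restrictScalars ℝ).comp p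
    (hasFDerivAt_zeta p)
  have h2 : fderiv ℝ (fun q => Hd l (zeta q)) p = _ := h1.fderiv
  unfold Lop
  rw [h2]
  simp
  linear_combination 2 * (deriv (Hd l) (zeta p)) * p.1.im * I_mul_I

lemma integral_Lop {w : ℂ × ℝ → ℂ} (hw : ContDiff ℝ 1 w) (hc : HasCompactSupport w) :
    ∫ p, Lop w p = 0 := by
  have key : ∀ (g : ℂ × ℝ → ℂ) (v : ℂ × ℝ), ContDiff ℝ 1 g → HasCompactSupport g →
      Integrable (fun p => fderiv ℝ g p v) ∧ ∫ p, fderiv ℝ g p v = 0 := by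
    intro g v hg hgc
    have : (volume : Measure (ℂ × ℝ)).IsAddHaarMeasure := by
      rw [Measure.volume_eq_prod]; infer_instance
    have i1 : Integrable (fun p => fderiv ℝ g p v) := by
      apply Continuous.integrable_of_hasCompactSupport
      · exact (hg.continuous_fderiv (by norm_num)).clm_apply continuous_const
      · exact hgc.fderiv_apply (𝕜 := ℝ) v
    refine ⟨i1, ?_⟩
    have := integral_mul_fderiv_eq_neg_fderiv_mul_of_integrable (μ := (volume : Measure (ℂ × ℝ)))
      (f := fun _ : ℂ × ℝ => (1 : ℂ)) (g := g) (v := v) (by simp) (by simpa using i1)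
      (by simpa using hg.continuous.integrable_of_hasCompactSupport hgc) (by fun_prop)
      (fun x _ => hg.differentiable (by norm_num) x)
    simpa using this
  have hd : Differentiable ℝ w := hw.differentiable (by norm_num)
  let c1 : ℂ × ℝ → ℂ := fun p => (p.1.im : ℂ) - I * p.1.re
  have hc1 : ContDiff ℝ 1 c1 := by
    have : c1 = fun p => ofRealCLM (imCLM p.1) - I * ofRealCLM (reCLM p.1) := by
      funext p; simp [c1]
    rw [this]; fun_prop
  have e : ∀ p, Lop w p = (fderiv ℝ w p (1, 0) + I * fderiv ℝ w p (I, 0)) / 2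
      + fderiv ℝ (fun q => c1 q * w q) p (0, 1) := by
    intro p
    rw [fderiv_fun_mul (hc1.differentiable (by norm_num) p) (hd p)]
    have : fderiv ℝ c1 p (0, 1) = 0 := by
      have : c1 = fun p => ofRealCLM (imCLM p.1) - I * ofRealCLM (reCLM p.1) := by
        funext p; simp [c1]
      have h1 : HasFDerivAt (fun p : ℂ × ℝ => ofRealCLM (imCLM p.1)) _ p :=
        (ofRealCLM.comp (imCLM.comp (ContinuousLinearMap.fst ℝ ℂ ℝ))).hasFDerivAt
      have h2 : HasFDerivAt (fun p : ℂ × ℝ => ofRealCLM (reCLM p.1)) _ p :=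
        (ofRealCLM.comp (reCLM.comp (ContinuousLinearMap.fst ℝ ℂ ℝ))).hasFDerivAt
      rw [this]
      erw [(h1.sub (h2.const_mul I)).fderiv]
      simp
    have a1 : ((1 : ℂ), 2 * p.1.im) = (1, 0) + (2 * p.1.im) • ((0 : ℂ), (1 : ℝ)) := by simp
    have a2 : ((I : ℂ), -2 * p.1.re) = (I, 0) + (-2 * p.1.re) • ((0 : ℂ), (1 : ℝ)) := by simp
    unfold Lop
    rw [a1, a2]
    simp only [map_add, map_smul]
    simp [this, c1]
    ring
  simp_rw [e]
  obtain ⟨i1, e1⟩ := key w (1, 0) hw hc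
  obtain ⟨i2, e2⟩ := key w (I, 0) hw hc
  obtain ⟨i3, e3⟩ := key (fun q => c1 q * w q) (0, 1) (hc1.mul hw) hc.mul_left
  rw [integral_add _ i3, e3, integral_div, integral_add i1 (i2.const_mul I), integral_const_mul,
    e1, e2]
  · simp
  · exact (i1.add (i2.const_mul I)).div_const 2


lemma norm_Hf (l : ℝ) (x y : ℝ) : ‖Hf l (x + I * y)‖ = Real.exp (l * (-y - x ^ 2 + y ^ 2)) := by
  unfold Hf
  rw [Complex.norm_exp]
  congr 1
  simp [pow_two]
  left
  ring

lemma norm_Hf_le {l x y R : ℝ} (hl : 0 ≤ l) (hR : R ≤ x ^ 2 + y - y ^ 2) :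
    ‖Hf l (x + I * y)‖ ≤ Real.exp (-l * R) := by
  rw [norm_Hf]
  apply Real.exp_le_exp.2
  nlinarith

lemma norm_Hd_le {l x y R : ℝ} (hl : 0 ≤ l) (hR : R ≤ x ^ 2 + y - y ^ 2) (hx : |x| ≤ 1 / 2)
    (hy : |y| ≤ 1 / 2) :
    ‖Hd l (x + I * y)‖ ≤ 3 * l * Real.exp (-l * R) := by
  unfold Hd
  rw [norm_mul, norm_mul]
  have h1 : ‖(l : ℂ)‖ = l := by simp [abs_of_nonneg hl]
  have h2 : ‖I - 2 * ((x : ℂ) + I * y)‖ ≤ 3 := by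
    calc ‖I - 2 * ((x : ℂ) + I * y)‖ ≤ ‖I‖ + ‖2 * ((x : ℂ) + I * y)‖ := norm_sub_le _ _
      _ ≤ 1 + 2 * (|x| + |y|) := by
        rw [norm_I, norm_mul]
        have : ‖(x : ℂ) + I * y‖ ≤ |x| + |y| := by
          refine (norm_add_le _ _).trans ?_
          simp
        have : ‖(2 : ℂ)‖ = 2 := by simp
        rw [this]; gcongr
      _ ≤ 3 := by linarith
  rw [h1]
  have := norm_Hf_le (R := R) hl hR
  calc l * ‖I - 2 * ((x : ℂ) + I * y)‖ * ‖Hf l (x + I * y)‖ ≤ l * 3 * Real.exp (-l * R) := by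
        gcongr
    _ = _ := by ring

theorem lemA (k : ℕ) (W : Set (ℂ × ℝ)) (hWo : IsOpen W) (hW : KK k ⊆ W) (u : ℂ × ℝ → ℂ)
    (hu : ContDiffOn ℝ 1 u W) (f : ℂ × ℝ → ℂ) (hf : Continuous f)
    (huf : ∀ p ∈ W, Lop u p = f p) :
    ∃ N : ℕ, ∀ l : ℝ, 0 ≤ l →
      ‖∫ p, f p * phiT k l p‖ ≤ N * l * Real.exp (-l * rad k ^ 2) := by
  obtain ⟨M, hM⟩ := (isCompact_KK k).exists_bound_of_continuousOn (hu.continuousOn.mono hW)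
  have hLc : Continuous (Lop (etaC k)) := by
    have hcd := (contDiff_etaC k).continuous_fderiv (by norm_num)
    unfold Lop
    fun_prop
  have hLs : HasCompactSupport (Lop (etaC k)) := by
    refine HasCompactSupport.intro (isCompact_KK k) fun p hp => ?_
    rw [Lop_congr (etaC_ev_zero hp), Lop_zero]
  have hLi : Integrable (fun p => ‖Lop (etaC k) p‖) :=
    (hLc.integrable_of_hasCompactSupport hLs).norm
  obtain ⟨N, hN⟩ := exists_nat_ge (3 * M * ∫ p, ‖Lop (etaC k) p‖)
  refine ⟨N, fun l hl => ?_⟩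
  have hphis : HasCompactSupport (phiT k l) := by
    refine HasCompactSupport.intro (isCompact_KK k) fun p hp => ?_
    rw [phiT, etaC_zero hp, zero_mul]
  have hphi := contDiff_phiT k l
  have hw : ContDiff ℝ 1 (fun p => u p * phiT k l p) := by
    rw [contDiff_iff_contDiffAt]
    intro p
    by_cases hp : p ∈ W
    · exact (hu.contDiffAt (hWo.mem_nhds hp)).mul hphi.contDiffAt
    · have hp' : p ∉ KK k := fun h => hp (hW h)
      have : (fun p => u p * phiT k l p) =ᶠ[𝓝 p] fun _ => 0 := by
        filter_upwards [etaC_ev_zero hp'] with q hq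
        rw [phiT, hq]; simp
      exact contDiffAt_const.congr_of_eventuallyEq this
  have hws : HasCompactSupport (fun p => u p * phiT k l p) := hphis.mul_left
  have e0 := integral_Lop hw hws
  have e1 : ∀ p, Lop (fun p => u p * phiT k l p) p =
      f p * phiT k l p + u p * (Hd l (zeta p) * Lop (etaC k) p) := by
    intro p
    by_cases hp : p ∈ W
    · have hup : DifferentiableAt ℝ u p :=
        (hu.contDiffAt (hWo.mem_nhds hp)).differentiableAt (by norm_num)
      rw [Lop_mul hup (hphi.differentiable (by norm_num) p), huf p hp]
      have : Lop (phiT k l) p = _ := Lop_mul ((contDiff_etaC k).differentiable (by norm_num) p)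
        (((contDiff_Hd l (n := 1)).comp contDiff_zeta).differentiable (by norm_num) p)
      rw [this]
      have := Lop_Hd l p
      rw [this]
      ring
    · have hp' : p ∉ KK k := fun h => hp (hW h)
      have : (fun p => u p * phiT k l p) =ᶠ[𝓝 p] 0 := by
        filter_upwards [etaC_ev_zero hp'] with q hq
        rw [phiT, hq]; simp
      rw [Lop_congr this, Lop_congr (etaC_ev_zero hp'), Lop_zero, phiT, etaC_zero hp']
      simp
  have hLwc : Continuous (Lop (fun p => u p * phiT k l p)) := by
    have hcd := hw.continuous_fderiv (by norm_num)
    unfold Lop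
    fun_prop
  have i1 : Integrable (fun p => f p * phiT k l p) :=
    (hf.mul hphi.continuous).integrable_of_hasCompactSupport hphis.mul_left
  have i2 : Integrable (Lop (fun p => u p * phiT k l p)) := by
    refine hLwc.integrable_of_hasCompactSupport ?_
    refine HasCompactSupport.intro (isCompact_KK k) fun p hp => ?_
    rw [e1, phiT, etaC_zero hp, Lop_congr (etaC_ev_zero hp), Lop_zero]; simp
  have i3 : Integrable (fun p => u p * (Hd l (zeta p) * Lop (etaC k) p)) := by
    refine (i2.sub i1).congr (Filter.Eventually.of_forall fun p => ?_)
    simp only [Pi.sub_apply, e1]; ring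
  simp_rw [e1] at e0
  rw [integral_add i1 i3] at e0
  rw [eq_neg_of_add_eq_zero_left e0, norm_neg]
  have hb : ∀ p, ‖u p * (Hd l (zeta p) * Lop (etaC k) p)‖ ≤
      M * (3 * l * Real.exp (-l * rad k ^ 2)) * ‖Lop (etaC k) p‖ := by
    intro p
    by_cases h0 : Lop (etaC k) p = 0
    · simp [h0]
    have hpK : p ∈ KK k := by
      by_contra hp
      exact h0 (by rw [Lop_congr (etaC_ev_zero hp), Lop_zero])
    have hor : rad k ≤ |p.2| ∨ rad k ≤ normSq p.1 := by
      by_contra! hcon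
      exact h0 (by rw [Lop_congr (etaC_ev_one hcon.1 hcon.2), Lop_one])
    have hr0 := rad_pos k
    have hr1 := rad_le k
    have hn := normSq_nonneg p.1
    have hy : normSq p.1 ≤ 2 * rad k := hpK.2
    have hx : |p.2| ≤ 2 * rad k := hpK.1
    have hR : rad k ^ 2 ≤ p.2 ^ 2 + normSq p.1 - normSq p.1 ^ 2 := by
      rcases hor with h | h
      · have : rad k ^ 2 ≤ p.2 ^ 2 := by rw [← sq_abs p.2]; gcongr
        nlinarith
      · nlinarith [sq_nonneg p.2]
    have h1 := norm_Hd_le (l := l) hl hR (by linarith)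
      (by rw [abs_of_nonneg hn]; linarith)
    rw [norm_mul, norm_mul, ← mul_assoc]
    have h2 : ‖Hd l (zeta p)‖ ≤ _ := h1
    have hM0 : 0 ≤ M := (norm_nonneg _).trans (hM p hpK)
    gcongr
    exact hM p hpK
  refine (norm_integral_le_of_norm_le (hLi.const_mul _) (Filter.Eventually.of_forall hb)).trans ?_
  rw [integral_const_mul]
  calc _ = (3 * M * ∫ p, ‖Lop (etaC k) p‖) * (l * Real.exp (-l * rad k ^ 2)) := by ring
    _ ≤ N * (l * Real.exp (-l * rad k ^ 2)) := by gcongr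
    _ = _ := by ring


def Dk (k : ℕ) (y : ℝ) : ℝ := deriv (fun y : ℝ => chi k (y ^ 2)) y

lemma hasDerivAt_Hf (l : ℝ) (w : ℂ) : HasDerivAt (Hf l) (Hd l w) w := by
  unfold Hf Hd
  have h1 : HasDerivAt (fun w : ℂ => (l : ℂ) * (I * w - w ^ 2)) (l * (I * 1 - 2 * w)) w := by
    have := (((hasDerivAt_id w).const_mul I).sub (hasDerivAt_pow 2 w)).const_mul (l : ℂ)
    simpa using this
  have h2 := h1.cexp
  refine h2.congr_deriv ?_
  simp only [Hf]
  ring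

lemma hasDerivAt_Hf_sq (l x y : ℝ) :
    HasDerivAt (fun y : ℝ => Hf l (x + I * ((y ^ 2 : ℝ) : ℂ)))
      (2 * I * y * Hd l (x + I * ((y ^ 2 : ℝ) : ℂ))) y := by
  have h0 : HasDerivAt (fun y : ℝ => ((y ^ 2 : ℝ) : ℂ)) ((2 * y : ℝ) : ℂ) y := by
    have := (hasDerivAt_pow 2 y).ofReal_comp
    simpa using this
  have h1 : HasDerivAt (fun y : ℝ => (x : ℂ) + I * ((y ^ 2 : ℝ) : ℂ)) (I * ((2 * y : ℝ) : ℂ)) y :=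
    (h0.const_mul I).const_add _
  have h2 := (hasDerivAt_Hf l (x + I * ((y ^ 2 : ℝ) : ℂ))).comp y h1
  refine h2.congr_deriv ?_
  push_cast; ring

lemma contDiff_chisq (k : ℕ) : ContDiff ℝ 1 (fun y : ℝ => chi k (y ^ 2)) :=
  (chi k).contDiff.comp (contDiff_id.pow 2)

lemma chisq_zero {k : ℕ} {y : ℝ} (hy : 2 * rad k ≤ y ^ 2) : chi k (y ^ 2) = 0 := by
  apply (chi k).zero_of_le_dist
  simp only [chi, dist_zero_right, Real.norm_eq_abs]
  exact hy.trans (le_abs_self _)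

lemma chisq_cs (k : ℕ) : HasCompactSupport (fun y : ℝ => chi k (y ^ 2)) := by
  refine HasCompactSupport.intro (isCompact_Icc (a := (-1 : ℝ)) (b := 1)) fun y hy => ?_
  apply chisq_zero
  have hr := rad_le k
  have : 1 < y ^ 2 := by
    rw [← sq_abs]
    have : 1 < |y| := by
      rw [lt_abs]
      simp only [Set.mem_Icc, not_and_or, not_le] at hy
      rcases hy with h | h
      · right; linarith
      · left; exact h
    nlinarith
  linarith

lemma Dk_cont (k : ℕ) : Continuous (Dk k) := (contDiff_chisq k).continuous_deriv (by norm_num)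

lemma Dk_ne {k : ℕ} {y : ℝ} (h : Dk k y ≠ 0) : rad k ≤ y ^ 2 ∧ y ^ 2 ≤ 2 * rad k := by
  constructor
  · by_contra! hc
    apply h
    have : (fun y : ℝ => chi k (y ^ 2)) =ᶠ[𝓝 y] fun _ => 1 := by
      have o : IsOpen {y : ℝ | y ^ 2 < rad k} := isOpen_lt (by fun_prop) continuous_const
      filter_upwards [o.mem_nhds hc] with q hq
      apply (chi k).one_of_mem_closedBall
      simp only [chi, Metric.mem_closedBall, dist_zero_right, Real.norm_eq_abs]
      rw [abs_of_nonneg (sq_nonneg _)]; exact le_of_lt hq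
    rw [Dk, this.deriv_eq]; simp
  · by_contra! hc
    apply h
    have : (fun y : ℝ => chi k (y ^ 2)) =ᶠ[𝓝 y] fun _ => 0 := by
      have o : IsOpen {y : ℝ | 2 * rad k < y ^ 2} := isOpen_lt continuous_const (by fun_prop)
      filter_upwards [o.mem_nhds hc] with q hq
      exact chisq_zero (le_of_lt hq)
    rw [Dk, this.deriv_eq]; simp

def Mx (k : ℕ) (l x : ℝ) : ℂ := ∫ z : ℂ, (chi k (normSq z) : ℂ) * Hd l (x + I * (normSq z : ℝ))

lemma Dk_int (k : ℕ) : Integrable (Dk k) :=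
  (Dk_cont k).integrable_of_hasCompactSupport (chisq_cs k).deriv

lemma Mx_bound (k : ℕ) (l x : ℝ) (hl : 0 ≤ l) :
    ‖Mx k l x - Real.pi * I * Hf l x‖ ≤
      Real.pi * (∫ y, ‖Dk k y‖) * Real.exp (-l * rad k ^ 2) := by
  let g : ℝ → ℂ := fun y => (chi k (y ^ 2) : ℂ) * Hd l (x + I * ((y ^ 2 : ℝ) : ℂ))
  have h1 : Mx k l x = ∫ z : ℂ, g ‖z‖ := by
    unfold Mx
    congr 1; funext z
    simp only [g]
    rw [normSq_eq_norm_sq]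
  have hvol : (volume : Measure ℂ).real (Metric.ball 0 1) = Real.pi := by
    simp [Measure.real, Complex.volume_ball]
  have h2 : Mx k l x = 2 * Real.pi * ∫ y in Set.Ioi (0 : ℝ), (y : ℂ) * g y := by
    rw [h1, integral_fun_norm_addHaar volume g, hvol, Complex.finrank_real_complex]
    simp [mul_assoc]
  let P : ℝ → ℂ := fun y => (chi k (y ^ 2) : ℂ) * Hf l (x + I * ((y ^ 2 : ℝ) : ℂ))
  have hPd : ∀ y, HasDerivAt P ((Dk k y : ℂ) * Hf l (x + I * ((y ^ 2 : ℝ) : ℂ)) +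
      2 * I * (y * g y)) y := by
    intro y
    have a := ((contDiff_chisq k).differentiable (by norm_num) y).hasDerivAt.ofReal_comp
    have b := a.mul (hasDerivAt_Hf_sq l x y)
    refine b.congr_deriv ?_
    simp only [g, Dk]
    ring
  have hHc : Continuous (Hf l) := by unfold Hf; fun_prop
  have hHdc : Continuous (Hd l) := (differentiable_Hd l).continuous
  have hcc : Continuous (fun y : ℝ => chi k (y ^ 2)) := (contDiff_chisq k).continuous
  have hDc := Dk_cont k
  have hgc : Continuous g := by
    have : Continuous fun y : ℝ => Hd l (x + I * ((y ^ 2 : ℝ) : ℂ)) := hHdc.comp (by fun_prop)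
    exact (continuous_ofReal.comp hcc).mul this
  have hHyc : Continuous fun y : ℝ => Hf l (x + I * ((y ^ 2 : ℝ) : ℂ)) := hHc.comp (by fun_prop)
  have hPderiv : deriv P = fun y => ((Dk k y : ℂ) * Hf l (x + I * ((y ^ 2 : ℝ) : ℂ)) +
      2 * I * (y * g y)) := funext fun y => (hPd y).deriv
  have hPcd : ContDiff ℝ 1 P := by
    rw [contDiff_one_iff_deriv]
    refine ⟨fun y => (hPd y).differentiableAt, ?_⟩
    rw [hPderiv]
    fun_prop
  have hPcs : HasCompactSupport P := by
    have : HasCompactSupport (fun y : ℝ => (chi k (y ^ 2) : ℂ)) :=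
      (chisq_cs k).comp_left (g := fun t : ℝ => (t : ℂ)) (by simp)
    exact this.mul_right
  have h3 := hPcs.integral_Ioi_deriv_eq hPcd 0
  have hP0 : P 0 = Hf l x := by
    have : chi k ((0 : ℝ) ^ 2) = 1 := by
      apply (chi k).one_of_mem_closedBall
      simp [chi, (rad_pos k).le]
    simp only [P, this]; simp
  have hi1 : Integrable (fun y : ℝ => (Dk k y : ℂ) * Hf l (x + I * ((y ^ 2 : ℝ) : ℂ))) := by
    refine Continuous.integrable_of_hasCompactSupport (by fun_prop) ?_
    have : HasCompactSupport (fun y : ℝ => (Dk k y : ℂ)) :=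
      (chisq_cs k).deriv.comp_left (g := fun t : ℝ => (t : ℂ)) (by simp)
    exact this.mul_right
  have hi2 : Integrable (fun y : ℝ => 2 * I * (y * g y)) := by
    refine Continuous.integrable_of_hasCompactSupport (by fun_prop) ?_
    have : HasCompactSupport (fun y : ℝ => (chi k (y ^ 2) : ℂ)) :=
      (chisq_cs k).comp_left (g := fun t : ℝ => (t : ℂ)) (by simp)
    exact ((this.mul_right).mul_left).mul_left
  rw [hPderiv, hP0, integral_add hi1.integrableOn hi2.integrableOn, integral_const_mul] at h3
  have h4 : Mx k l x - Real.pi * I * Hf l x = Real.pi * I *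
      ∫ y in Set.Ioi (0 : ℝ), (Dk k y : ℂ) * Hf l (x + I * ((y ^ 2 : ℝ) : ℂ)) := by
    rw [h2]
    linear_combination (-Real.pi * I) * h3 + (2 * Real.pi * ∫ y in Set.Ioi (0 : ℝ), (y : ℂ) * g y) * I_mul_I
  rw [h4, norm_mul, norm_mul, norm_I, mul_one, norm_real, Real.norm_eq_abs,
    abs_of_pos Real.pi_pos, mul_assoc]
  gcongr
  have hb : ∀ y, ‖(Dk k y : ℂ) * Hf l (x + I * ((y ^ 2 : ℝ) : ℂ))‖ ≤
      ‖Dk k y‖ * Real.exp (-l * rad k ^ 2) := by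
    intro y
    by_cases h0 : Dk k y = 0
    · simp [h0]
    obtain ⟨ha, hb⟩ := Dk_ne h0
    have hr0 := rad_pos k
    have hr1 := rad_le k
    rw [norm_mul, norm_real]
    gcongr
    apply norm_Hf_le hl
    nlinarith [sq_nonneg x]
  refine (norm_integral_le_of_norm_le (((Dk_int k).norm.mul_const _).integrableOn)
    (Filter.Eventually.of_forall hb)).trans ?_
  rw [integral_mul_const]
  gcongr
  · exact Filter.Eventually.of_forall fun y => norm_nonneg _
  · exact (Dk_int k).norm
  · exact Measure.restrict_le_self

theorem lemB (k : ℕ) : ∃ C : ℝ, ∀ l : ℝ, 0 ≤ l →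
    Real.pi * (rad k * Real.exp (-l * (rad k ^ 2 / 4)) - C * Real.exp (-l * rad k ^ 2)) ≤
      ‖∫ p : ℂ × ℝ, cexp (-I * l * p.2) * phiT k l p‖ := by
  refine ⟨(∫ y, ‖Dk k y‖) * ∫ x, chi k x, fun l hl => ?_⟩
  have hchi : Integrable (chi k : ℝ → ℝ) :=
    (chi k).continuous.integrable_of_hasCompactSupport (chi k).hasCompactSupport
  have hphis : HasCompactSupport (phiT k l) := by
    refine HasCompactSupport.intro (isCompact_KK k) fun p hp => ?_
    rw [phiT, etaC_zero hp, zero_mul]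
  have hint : Integrable (fun p : ℂ × ℝ => cexp (-I * l * p.2) * phiT k l p) := by
    refine Continuous.integrable_of_hasCompactSupport ?_ hphis.mul_left
    have := (contDiff_phiT k l).continuous
    fun_prop
  have hfac : ∀ x : ℝ, ∫ z : ℂ, cexp (-I * l * x) * phiT k l (z, x) =
      (chi k x : ℂ) * cexp (-I * l * x) * Mx k l x := by
    intro x
    unfold Mx
    rw [← integral_const_mul]
    congr 1; funext z
    simp only [phiT, etaC, zeta]
    push_cast; ring
  have e1 : ∫ p : ℂ × ℝ, cexp (-I * l * p.2) * phiT k l p =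
      ∫ x : ℝ, (chi k x : ℂ) * cexp (-I * l * x) * Mx k l x := by
    rw [Measure.volume_eq_prod] at hint ⊢
    rw [integral_prod_symm _ hint]
    simp only [hfac]
  have i1 : Integrable (fun x : ℝ => (chi k x : ℂ) * cexp (-I * l * x) * Mx k l x) := by
    rw [Measure.volume_eq_prod] at hint
    have := hint.integral_prod_right
    simpa only [hfac] using this
  have e2 : ∀ x : ℝ, cexp (-I * l * x) * Hf l x = (Real.exp (-l * x ^ 2) : ℝ) := by
    intro x
    unfold Hf
    rw [← Complex.exp_add]
    push_cast
    congr 1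
    ring
  have i2r : Integrable (fun x : ℝ => chi k x * Real.exp (-l * x ^ 2)) := by
    refine Continuous.integrable_of_hasCompactSupport ?_ (chi k).hasCompactSupport.mul_right
    have := (chi k).continuous
    fun_prop
  have i2 : Integrable (fun x : ℝ => Real.pi * I * ((chi k x * Real.exp (-l * x ^ 2) : ℝ) : ℂ)) :=
    i2r.ofReal.const_mul _
  set J : ℝ := ∫ x : ℝ, chi k x * Real.exp (-l * x ^ 2) with hJ
  have e3 : ‖(∫ x : ℝ, (chi k x : ℂ) * cexp (-I * l * x) * Mx k l x) - Real.pi * I * J‖ ≤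
      Real.pi * ((∫ y, ‖Dk k y‖) * ∫ x, chi k x) * Real.exp (-l * rad k ^ 2) := by
    rw [hJ, ← integral_complex_ofReal, ← integral_const_mul, ← integral_sub i1 i2]
    have hb : ∀ x : ℝ, ‖(chi k x : ℂ) * cexp (-I * l * x) * Mx k l x -
        Real.pi * I * ((chi k x * Real.exp (-l * x ^ 2) : ℝ) : ℂ)‖ ≤
        chi k x * (Real.pi * (∫ y, ‖Dk k y‖) * Real.exp (-l * rad k ^ 2)) := by
      intro x
      have : (chi k x : ℂ) * cexp (-I * l * x) * Mx k l x -
        Real.pi * I * ((chi k x * Real.exp (-l * x ^ 2) : ℝ) : ℂ) =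
          (chi k x : ℂ) * cexp (-I * l * x) * (Mx k l x - Real.pi * I * Hf l x) := by
        rw [ofReal_mul, ← e2]; ring
      rw [this, norm_mul, norm_mul, norm_real, Real.norm_eq_abs, abs_of_nonneg (chi k).nonneg]
      have h1 : ‖cexp (-I * l * x)‖ = 1 := by
        rw [Complex.norm_exp]; simp
      rw [h1, mul_one]
      have := (chi k).nonneg (x := x)
      gcongr
      exact Mx_bound k l x hl
    refine (norm_integral_le_of_norm_le (hchi.mul_const _)
      (Filter.Eventually.of_forall hb)).trans ?_
    rw [integral_mul_const]
    apply le_of_eq; ring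
  have hr0 := rad_pos k
  have e4 : rad k * Real.exp (-l * (rad k ^ 2 / 4)) ≤ J := by
    have : ∫ x in Set.Icc (-(rad k / 2)) (rad k / 2), Real.exp (-l * (rad k ^ 2 / 4)) =
        rad k * Real.exp (-l * (rad k ^ 2 / 4)) := by
      rw [setIntegral_const, Real.volume_real_Icc_of_le (by linarith), smul_eq_mul]
      ring
    rw [← this]
    have hnn : ∀ x, 0 ≤ chi k x * Real.exp (-l * x ^ 2) := fun x =>
      mul_nonneg (chi k).nonneg (Real.exp_pos _).le
    refine le_trans ?_ (setIntegral_le_integral i2r (Filter.Eventually.of_forall hnn)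
      (s := Set.Icc (-(rad k / 2)) (rad k / 2)))
    apply setIntegral_mono_on
    · exact integrableOn_const (by simp)
    · exact i2r.integrableOn
    · exact measurableSet_Icc
    · intro x hx
      have : chi k x = 1 := by
        apply (chi k).one_of_mem_closedBall
        simp only [chi, Metric.mem_closedBall, dist_zero_right, Real.norm_eq_abs]
        rw [abs_le]; constructor <;> linarith [hx.1, hx.2]
      rw [this, one_mul]
      apply Real.exp_le_exp.2
      have : x ^ 2 ≤ rad k ^ 2 / 4 := by nlinarith [hx.1, hx.2]
      nlinarith
  rw [e1]
  have hJ0 : 0 ≤ J := le_trans (by positivity) e4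
  have e5 : ‖Real.pi * I * (J : ℂ)‖ = Real.pi * J := by
    rw [norm_mul, norm_mul, norm_I, norm_real, norm_real, Real.norm_eq_abs, Real.norm_eq_abs,
      abs_of_pos Real.pi_pos, abs_of_nonneg hJ0]; ring
  have e6 := norm_sub_norm_le (Real.pi * I * (J : ℂ))
    (∫ x : ℝ, (chi k x : ℂ) * cexp (-I * l * x) * Mx k l x)
  rw [norm_sub_rev] at e6
  have e7 : Real.pi * (rad k * Real.exp (-l * (rad k ^ 2 / 4))) ≤ Real.pi * J := by
    gcongr
  rw [e5] at e6
  rw [mul_sub]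
  linarith [e3, e6, e7]


def rho (t : ℝ) : ℝ := Real.exp t * Real.smoothTransition (1 - t)

lemma rho_of_nonpos {t : ℝ} (h : t ≤ 0) : rho t = Real.exp t := by
  rw [rho, Real.smoothTransition.one_of_one_le (by linarith), mul_one]

lemma rho_of_ge {t : ℝ} (h : 1 ≤ t) : rho t = 0 := by
  rw [rho, Real.smoothTransition.zero_of_nonpos (by linarith), mul_zero]

def rhoC (t : ℝ) : ℂ := (rho t : ℂ)

lemma contDiff_rhoC : ContDiff ℝ (⊤ : ℕ∞) rhoC := by
  have : ContDiff ℝ (⊤ : ℕ∞) rho :=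
    Real.contDiff_exp.mul (Real.smoothTransition.contDiff.comp (contDiff_const.sub contDiff_id))
  exact ofRealCLM.contDiff.comp this

lemma iteratedDeriv_exp_ofReal (n : ℕ) (c : ℂ) :
    iteratedDeriv n (fun t : ℝ => cexp (c * t)) = fun t : ℝ => c ^ n * cexp (c * t) := by
  induction n with
  | zero => simp
  | succ n ih =>
    rw [iteratedDeriv_succ, ih]
    funext t
    have h0 : HasDerivAt (fun t : ℝ => c * (t : ℂ)) (c * 1) t :=
      (hasDerivAt_id t).ofReal_comp.const_mul c
    have := (h0.cexp.const_mul (c ^ n)).deriv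
    rw [this]; ring

lemma rhoC_bdd (n : ℕ) : ∃ C : ℝ, 0 ≤ C ∧ ∀ t, ‖iteratedFDeriv ℝ n rhoC t‖ ≤ C := by
  have hc : Continuous (iteratedDeriv n rhoC) :=
    contDiff_rhoC.continuous_iteratedDeriv n (by exact_mod_cast le_top)
  obtain ⟨M, hM⟩ := (isCompact_Icc (a := (0 : ℝ)) (b := 1)).exists_bound_of_continuousOn
    hc.continuousOn
  refine ⟨max M 1, le_max_of_le_right zero_le_one, fun t => ?_⟩
  rw [norm_iteratedFDeriv_eq_norm_iteratedDeriv]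
  rcases lt_or_ge t 0 with h | h
  · have : rhoC =ᶠ[𝓝 t] fun t : ℝ => cexp (1 * t) := by
      filter_upwards [isOpen_Iio.mem_nhds h] with s hs
      rw [rhoC, rho_of_nonpos (le_of_lt hs)]; simp
    rw [this.iteratedDeriv_eq, iteratedDeriv_exp_ofReal]
    apply le_max_of_le_right
    simp only [one_pow, one_mul]
    rw [Complex.norm_exp]
    simpa using h.le
  rcases le_or_gt t 1 with h' | h'
  · exact le_max_of_le_left (hM t ⟨h, h'⟩)
  · have : rhoC =ᶠ[𝓝 t] fun t : ℝ => 0 := by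
      filter_upwards [isOpen_Ioi.mem_nhds h'] with s hs
      rw [rhoC, rho_of_ge (le_of_lt hs)]; simp
    rw [this.iteratedDeriv_eq]
    apply le_max_of_le_right
    simp [iteratedDeriv_fun_const_zero]

def ell (a : ℂ) : ℂ × ℝ × ℝ →L[ℝ] ℝ :=
  (ContinuousLinearMap.fst ℝ ℝ ℝ).comp (ContinuousLinearMap.snd ℝ ℂ (ℝ × ℝ)) +
    ((2 * a.re) • imCLM - (2 * a.im) • reCLM).comp (ContinuousLinearMap.fst ℝ ℂ (ℝ × ℝ))

lemma ell_apply (a z : ℂ) (x t : ℝ) :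
    ell a (z, x, t) = x + (2 * a.re * z.im - 2 * a.im * z.re) := by
  simp [ell]

def tt : ℂ × ℝ × ℝ →L[ℝ] ℝ :=
  (ContinuousLinearMap.snd ℝ ℝ ℝ).comp (ContinuousLinearMap.snd ℝ ℂ (ℝ × ℝ))

lemma norm_ell_le (a : ℂ) : ‖ell a‖ ≤ 1 + 4 * ‖a‖ := by
  refine ContinuousLinearMap.opNorm_le_bound _ (by positivity) ?_
  rintro ⟨z, x, t⟩
  rw [ell_apply]
  have hx : |x| ≤ ‖(z, x, t)‖ := (le_max_left |x| |t|).trans (le_max_right ‖z‖ _)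
  have hz : ‖z‖ ≤ ‖(z, x, t)‖ := le_max_left _ _
  have h1 := abs_re_le_norm a
  have h2 := abs_im_le_norm a
  have h3 := abs_re_le_norm z
  have h4 := abs_im_le_norm z
  have h5 : |2 * a.re * z.im| ≤ 2 * ‖a‖ * ‖z‖ := by
    rw [abs_mul, abs_mul, abs_two]; gcongr
  have h6 : |2 * a.im * z.re| ≤ 2 * ‖a‖ * ‖z‖ := by
    rw [abs_mul, abs_mul, abs_two]; gcongr
  rw [Real.norm_eq_abs]
  calc _ ≤ |x| + |2 * a.re * z.im - 2 * a.im * z.re| := abs_add_le _ _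
    _ ≤ |x| + (|2 * a.re * z.im| + |2 * a.im * z.re|) := by gcongr; exact abs_sub _ _
    _ ≤ |x| + 4 * ‖a‖ * ‖z‖ := by linarith
    _ ≤ ‖(z, x, t)‖ + 4 * ‖a‖ * ‖(z, x, t)‖ := by gcongr
    _ = _ := by ring

lemma norm_tt_le : ‖tt‖ ≤ 1 := by
  refine ContinuousLinearMap.opNorm_le_bound _ zero_le_one ?_
  rintro ⟨z, x, t⟩
  rw [one_mul]
  exact (le_max_right |x| |t|).trans (le_max_right ‖z‖ _)

def term (a : ℂ) (l : ℝ) (v : ℂ × ℝ × ℝ) : ℂ :=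
  cexp (-I * ((l * ell a v : ℝ) : ℂ)) * rhoC (l * tt v)

def E1 (s : ℝ) : ℂ := cexp (-I * s)

lemma contDiff_E1 : ContDiff ℝ (⊤ : ℕ∞) E1 := by
  have : E1 = fun s => cexp (-I * ofRealCLM s) := rfl
  rw [this]
  fun_prop

lemma term_eq (a : ℂ) (l : ℝ) :
    term a l = fun v => (E1 ∘ (l • ell a)) v * (rhoC ∘ (l • tt)) v := by
  funext v
  simp [term, E1]

lemma contDiff_term (a : ℂ) (l : ℝ) : ContDiff ℝ (⊤ : ℕ∞) (term a l) := by
  rw [term_eq]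
  exact (contDiff_E1.comp (l • ell a).contDiff).mul (contDiff_rhoC.comp (l • tt).contDiff)

lemma norm_comp_le {g : ℝ → ℂ} (hg : ContDiff ℝ (⊤ : ℕ∞) g) (A : ℂ × ℝ × ℝ →L[ℝ] ℝ) (i : ℕ)
    {C B : ℝ} (hC : ∀ t, ‖iteratedFDeriv ℝ i g t‖ ≤ C) (hB : ‖A‖ ≤ B) (v : ℂ × ℝ × ℝ) :
    ‖iteratedFDeriv ℝ i (g ∘ A) v‖ ≤ C * B ^ i := by
  rw [A.iteratedFDeriv_comp_right hg v (by exact_mod_cast le_top)]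
  refine (ContinuousMultilinearMap.norm_compContinuousLinearMap_le _ _).trans ?_
  simp only [Finset.prod_const, Finset.card_univ, Fintype.card_fin]
  have : 0 ≤ C := (norm_nonneg _).trans (hC 0)
  gcongr
  exact hC _

lemma term_bdd (i : ℕ) : ∃ K : ℝ, 0 ≤ K ∧ ∀ (a : ℂ) (l : ℝ), 0 ≤ l → ∀ v,
    ‖iteratedFDeriv ℝ i (term a l) v‖ ≤ K * (l * (1 + 4 * ‖a‖)) ^ i := by
  choose C hC0 hC using rhoC_bdd
  refine ⟨∑ j ∈ Finset.range (i + 1), (i.choose j : ℝ) * C (i - j),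
    Finset.sum_nonneg fun j _ => mul_nonneg (by positivity) (hC0 _), fun a l hl v => ?_⟩
  rw [term_eq]
  refine (norm_iteratedFDeriv_mul_le (N := (⊤ : ℕ∞)) (contDiff_E1.comp (l • ell a).contDiff)
    (contDiff_rhoC.comp (l • tt).contDiff) v (by exact_mod_cast le_top)).trans ?_
  rw [Finset.sum_mul]
  apply Finset.sum_le_sum
  intro j hj
  have hj' : j ≤ i := Nat.lt_succ_iff.1 (Finset.mem_range.1 hj)
  have n1 : ‖l • ell a‖ ≤ l * (1 + 4 * ‖a‖) := by
    rw [norm_smul, Real.norm_eq_abs, abs_of_nonneg hl]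
    gcongr; exact norm_ell_le a
  have n2 : ‖l • tt‖ ≤ l * (1 + 4 * ‖a‖) := by
    rw [norm_smul, Real.norm_eq_abs, abs_of_nonneg hl]
    gcongr
    exact norm_tt_le.trans (by linarith [norm_nonneg a])
  have b1 := norm_comp_le contDiff_E1 (l • ell a) j (C := 1) (fun t => by
    rw [norm_iteratedFDeriv_eq_norm_iteratedDeriv]
    unfold E1
    rw [iteratedDeriv_exp_ofReal, norm_mul, Complex.norm_exp]
    simp) n1 v
  have b2 := norm_comp_le contDiff_rhoC (l • tt) (i - j) (hC (i - j)) n2 v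
  have hB : 0 ≤ l * (1 + 4 * ‖a‖) := by positivity
  have hCC := hC0 (i - j)
  calc _ ≤ (i.choose j : ℝ) * (1 * (l * (1 + 4 * ‖a‖)) ^ j) *
        (C (i - j) * (l * (1 + 4 * ‖a‖)) ^ (i - j)) := by gcongr
    _ = (i.choose j : ℝ) * C (i - j) * ((l * (1 + 4 * ‖a‖)) ^ j *
          (l * (1 + 4 * ‖a‖)) ^ (i - j)) := by ring
    _ = _ := by rw [← pow_add, Nat.add_sub_cancel' hj']

def cf (c : ℕ → Bool) (n : ℕ) : ℝ := if c n then (1 / 2) ^ n else 0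

lemma cf_nonneg (c : ℕ → Bool) (n : ℕ) : 0 ≤ cf c n := by
  unfold cf; split_ifs <;> positivity

lemma cf_le (c : ℕ → Bool) (n : ℕ) : cf c n ≤ (1 / 2) ^ n := by
  unfold cf; split_ifs
  · exact le_rfl
  · positivity

def seqA (n : ℕ) : ℂ :=
  if ‖TopologicalSpace.denseSeq ℂ n.unpair.1‖ ≤ n then TopologicalSpace.denseSeq ℂ n.unpair.1 else 0

lemma seqA_le (n : ℕ) : ‖seqA n‖ ≤ n := by
  unfold seqA; split_ifs with h
  · exact h
  · simp

lemma seqA_freq (j m : ℕ) : ∃ n ≥ m, seqA n = TopologicalSpace.denseSeq ℂ j := by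
  obtain ⟨M, hM⟩ := exists_nat_ge ‖TopologicalSpace.denseSeq ℂ j‖
  refine ⟨Nat.pair j (max m M), (le_max_left m M).trans (Nat.right_le_pair _ _), ?_⟩
  unfold seqA
  rw [Nat.unpair_pair]
  simp only
  rw [if_pos]
  refine hM.trans ?_
  exact_mod_cast (le_max_right m M).trans (Nat.right_le_pair _ _)

def Om (c : ℕ → Bool) (v : ℂ × ℝ × ℝ) : ℂ := ∑' n, cf c n • term (seqA n) ((n : ℝ) ^ 2) v

lemma contDiff_Om (c : ℕ → Bool) : ContDiff ℝ (⊤ : ℕ∞) (Om c) := by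
  choose K hK0 hK using term_bdd
  refine contDiff_tsum (f := fun n v => cf c n • term (seqA n) ((n:ℝ)^2) v) (v := fun i n => (1 / 2) ^ n * (K i * ((n : ℝ) ^ 2 * (1 + 4 * n)) ^ i))
    (fun n => (contDiff_term _ _).const_smul (cf c n)) (fun i _ => ?_) (fun i n v _ => ?_)
  · have h1 : Summable fun n : ℕ => (n : ℝ) ^ (3 * i) * (1 / 2 : ℝ) ^ n :=
      summable_pow_mul_geometric_of_norm_lt_one _ (by norm_num)
    refine Summable.of_nonneg_of_le (fun n => ?_) (fun n => ?_) (h1.mul_left (K i * 5 ^ i))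
    · have := hK0 i; positivity
    · have := hK0 i
      have h2 : (n : ℝ) ^ 2 * (1 + 4 * n) ≤ 5 * (n : ℝ) ^ 3 := by
        rcases Nat.eq_zero_or_pos n with h | h
        · simp [h]
        · have : (1 : ℝ) ≤ n := by exact_mod_cast h
          nlinarith [sq_nonneg (n : ℝ)]
      calc _ ≤ (1 / 2 : ℝ) ^ n * (K i * (5 * (n : ℝ) ^ 3) ^ i) := by gcongr
        _ = _ := by rw [mul_pow, ← pow_mul]; ring
  · rw [iteratedFDeriv_const_smul_apply' ((contDiff_term _ _).of_le
      (by exact_mod_cast le_top)).contDiffAt, norm_smul, Real.norm_eq_abs,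
      abs_of_nonneg (cf_nonneg _ _)]
    have := hK0 i
    have h1 := seqA_le n
    gcongr
    · exact cf_le c n
    · refine (hK i (seqA n) _ (by positivity) v).trans ?_
      gcongr


def pb (a : ℂ) (b : ℝ) (p : ℂ × ℝ) : ℂ × ℝ :=
  (p.1 + a, p.2 + b - 2 * (a.re * p.1.im - a.im * p.1.re))

lemma continuous_pb (a : ℂ) (b : ℝ) : Continuous (pb a b) := by
  unfold pb
  have h1 : Continuous fun p : ℂ × ℝ => p.1.im := continuous_im.comp continuous_fst
  have h2 : Continuous fun p : ℂ × ℝ => p.1.re := continuous_re.comp continuous_fst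
  fun_prop

def tm (a : ℂ) (b : ℝ) (n : ℕ) (p : ℂ × ℝ) : ℂ :=
  term (seqA n) ((n : ℝ) ^ 2) ((pb a b p).1, (pb a b p).2, 0)

def ft (c : ℕ → Bool) (a : ℂ) (b : ℝ) (p : ℂ × ℝ) : ℂ := Om c ((pb a b p).1, (pb a b p).2, 0)

lemma tt_apply (z : ℂ) (x t : ℝ) : tt (z, x, t) = t := by simp [tt]

lemma norm_tm (a : ℂ) (b : ℝ) (n : ℕ) (p : ℂ × ℝ) : ‖tm a b n p‖ = 1 := by
  unfold tm term
  rw [tt_apply, mul_zero, rhoC, rho_of_nonpos le_rfl, Real.exp_zero, norm_mul, Complex.norm_exp]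
  generalize ((n : ℝ) ^ 2 * _ : ℝ) = s
  simp

lemma continuous_ft (c : ℕ → Bool) (a : ℂ) (b : ℝ) : Continuous (ft c a b) := by
  unfold ft
  have h := continuous_pb a b
  exact (contDiff_Om c).continuous.comp (by fun_prop)

lemma continuous_tm (a : ℂ) (b : ℝ) (n : ℕ) : Continuous (tm a b n) := by
  unfold tm
  have h := continuous_pb a b
  exact (contDiff_term _ _).continuous.comp (by fun_prop)

lemma norm_cf_tm (c : ℕ → Bool) (a : ℂ) (b : ℝ) (n : ℕ) (p : ℂ × ℝ) :
    ‖cf c n • tm a b n p‖ ≤ (1 / 2) ^ n := by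
  rw [norm_smul, norm_tm, mul_one, Real.norm_eq_abs, abs_of_nonneg (cf_nonneg _ _)]
  exact cf_le c n

lemma summable_tm (c : ℕ → Bool) (a : ℂ) (b : ℝ) (p : ℂ × ℝ) :
    Summable fun n => cf c n • tm a b n p :=
  Summable.of_norm_bounded summable_geometric_two (fun n => norm_cf_tm c a b n p)

lemma norm_ft (c : ℕ → Bool) (a : ℂ) (b : ℝ) (p : ℂ × ℝ) : ‖ft c a b p‖ ≤ 2 := by
  have := tsum_of_norm_bounded hasSum_geometric_two (fun n => norm_cf_tm c a b n p)
  exact this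

lemma continuous_ft_c (a : ℂ) (b : ℝ) (p : ℂ × ℝ) : Continuous fun c => ft c a b p := by
  have : (fun c => ft c a b p) = fun c => ∑' n, cf c n • tm a b n p := rfl
  rw [this]
  refine continuous_tsum (fun n => ?_) summable_geometric_two (fun n c => norm_cf_tm c a b n p)
  have h : Continuous fun c : ℕ → Bool => cf c n :=
    (continuous_of_discreteTopology (f := fun t : Bool => if t then ((1:ℝ) / 2) ^ n else 0)).comp
      (continuous_apply n)
  exact h.smul continuous_const

lemma phiT_cs (k : ℕ) (l : ℝ) : HasCompactSupport (phiT k l) := by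
  refine HasCompactSupport.intro (isCompact_KK k) fun p hp => ?_
  rw [phiT, etaC_zero hp, zero_mul]

lemma phiT_int (k : ℕ) (l : ℝ) : Integrable (phiT k l) :=
  (contDiff_phiT k l).continuous.integrable_of_hasCompactSupport (phiT_cs k l)

lemma mul_phiT_int (k : ℕ) (l : ℝ) {g : ℂ × ℝ → ℂ} (hg : Continuous g) :
    Integrable fun p => g p * phiT k l p :=
  (hg.mul (contDiff_phiT k l).continuous).integrable_of_hasCompactSupport (phiT_cs k l).mul_left

lemma continuous_J (a : ℂ) (b : ℝ) (k : ℕ) (l : ℝ) :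
    Continuous fun c => ∫ p, ft c a b p * phiT k l p := by
  refine continuous_of_dominated (bound := fun p => 2 * ‖phiT k l p‖)
    (fun c => (mul_phiT_int k l (continuous_ft c a b)).aestronglyMeasurable) (fun c => ?_)
    ((phiT_int k l).norm.const_mul 2) ?_
  · filter_upwards with p
    rw [norm_mul]
    gcongr
    exact norm_ft c a b p
  · filter_upwards with p
    exact (continuous_ft_c a b p).mul continuous_const

def ES (a : ℂ) (b : ℝ) (k N : ℕ) : Set (ℕ → Bool) :=
  {c | ∀ n : ℕ, ‖∫ p, ft c a b p * phiT k ((n : ℝ) ^ 2) p‖ ≤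
    N * (n : ℝ) ^ 2 * Real.exp (-(n : ℝ) ^ 2 * rad k ^ 2)}

lemma isClosed_ES (a : ℂ) (b : ℝ) (k N : ℕ) : IsClosed (ES a b k N) := by
  have : ES a b k N = ⋂ n : ℕ, {c | ‖∫ p, ft c a b p * phiT k ((n : ℝ) ^ 2) p‖ ≤
    N * (n : ℝ) ^ 2 * Real.exp (-(n : ℝ) ^ 2 * rad k ^ 2)} := by
    ext c; simp [ES]
  rw [this]
  exact isClosed_iInter fun n => isClosed_le (continuous_J a b k _).norm continuous_const

def cflip (c : ℕ → Bool) (n : ℕ) : ℕ → Bool := Function.update c n (!c n)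

lemma tendsto_flip (c : ℕ → Bool) : Filter.Tendsto (cflip c) Filter.atTop (𝓝 c) := by
  rw [tendsto_pi_nhds]
  intro i
  refine tendsto_const_nhds.congr' ?_
  filter_upwards [Filter.eventually_gt_atTop i] with n hn
  rw [cflip, Function.update_of_ne hn.ne]

lemma ft_flip (c : ℕ → Bool) (a : ℂ) (b : ℝ) (n : ℕ) (p : ℂ × ℝ) :
    ft (cflip c n) a b p - ft c a b p = ((cf (cflip c n) n - cf c n : ℝ) : ℂ) * tm a b n p := by
  have h1 : ft (cflip c n) a b p = ∑' m, cf (cflip c n) m • tm a b m p := rfl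
  have h2 : ft c a b p = ∑' m, cf c m • tm a b m p := rfl
  rw [h1, h2, ← (summable_tm _ a b p).tsum_sub (summable_tm _ a b p), tsum_eq_single n]
  · rw [← sub_smul, real_smul]
  · intro m hm
    have : cf (cflip c n) m = cf c m := by
      rw [cf, cflip, Function.update_of_ne hm, cf]
    rw [this, sub_self]

lemma abs_cf_flip (c : ℕ → Bool) (n : ℕ) : |cf (cflip c n) n - cf c n| = (1 / 2) ^ n := by
  unfold cf cflip
  rw [Function.update_self]
  cases c n <;> simp

lemma tm_eq (a : ℂ) (b : ℝ) (n : ℕ) (h : seqA n = a) (p : ℂ × ℝ) :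
    tm a b n p = cexp (-I * ((n : ℝ) ^ 2 : ℝ) * b) * cexp (-I * ((n : ℝ) ^ 2 : ℝ) * p.2) := by
  unfold tm term
  rw [h, tt_apply, mul_zero, rhoC, rho_of_nonpos le_rfl, Real.exp_zero, ell_apply, ← Complex.exp_add]
  have : (pb a b p).2 + (2 * a.re * (pb a b p).1.im - 2 * a.im * (pb a b p).1.re) = b + p.2 := by
    simp [pb]; ring
  rw [this]
  push_cast
  rw [mul_one]
  congr 1
  ring

lemma growth (q : ℝ) (hq : 0 < q) :
    Filter.Tendsto (fun n : ℕ => (8 : ℝ) ^ n * Real.exp (-q * (n : ℝ) ^ 2)) Filter.atTop (𝓝 0) := by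
  have h0 : Filter.Tendsto (fun n : ℕ => Real.exp (-(n : ℝ))) Filter.atTop (𝓝 0) :=
    Real.tendsto_exp_neg_atTop_nhds_zero.comp tendsto_natCast_atTop_atTop
  refine squeeze_zero' (Filter.Eventually.of_forall fun n => by positivity) ?_ h0
  obtain ⟨M, hM⟩ := exists_nat_ge ((Real.log 8 + 1) / q)
  filter_upwards [Filter.eventually_ge_atTop M] with n hn
  have hn' : (Real.log 8 + 1) / q ≤ n := hM.trans (by exact_mod_cast hn)
  rw [div_le_iff₀ hq] at hn'
  have : (8 : ℝ) ^ n = Real.exp (n * Real.log 8) := by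
    rw [mul_comm, ← Real.rpow_def_of_pos (by norm_num), Real.rpow_natCast]
  rw [this, ← Real.exp_add, Real.exp_le_exp]
  nlinarith [Nat.cast_nonneg (α := ℝ) n]

lemma ES_interior (j : ℕ) (b : ℝ) (k N : ℕ) :
    ¬ (interior (ES (TopologicalSpace.denseSeq ℂ j) b k N)).Nonempty := by
  rintro ⟨c, hc⟩
  set a := TopologicalSpace.denseSeq ℂ j with ha
  have hE : c ∈ ES a b k N := interior_subset hc
  have ev := (tendsto_flip c).eventually (isOpen_interior.mem_nhds hc)
  obtain ⟨C, hC⟩ := lemB k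
  have hr := rad_pos k
  set r := rad k with hrd
  set q := 3 / 4 * r ^ 2 with hq
  have hqp : 0 < q := by positivity
  have g0 := (growth q hqp).const_mul (2 * N + Real.pi * |C|)
  rw [mul_zero] at g0
  have ev2 := g0.eventually (gt_mem_nhds (show 0 < Real.pi * r by positivity))
  obtain ⟨m, hm⟩ := Filter.eventually_atTop.1 (ev.and ev2)
  obtain ⟨n, hn, hna⟩ := seqA_freq j m
  obtain ⟨h1, h2⟩ := hm n hn
  have hE1 := interior_subset h1 n
  have hE2 := hE n
  have key : (1 / 2 : ℝ) ^ n * ‖∫ p : ℂ × ℝ, cexp (-I * ((n : ℝ) ^ 2 : ℝ) * p.2) * phiT k ((n : ℝ) ^ 2) p‖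
      ≤ 2 * (N * (n : ℝ) ^ 2 * Real.exp (-(n : ℝ) ^ 2 * r ^ 2)) := by
    have e1 : (∫ p, ft (cflip c n) a b p * phiT k ((n : ℝ) ^ 2) p) -
        (∫ p, ft c a b p * phiT k ((n : ℝ) ^ 2) p) =
        ((cf (cflip c n) n - cf c n : ℝ) : ℂ) * cexp (-I * ((n : ℝ) ^ 2 : ℝ) * b) *
        ∫ p : ℂ × ℝ, cexp (-I * ((n : ℝ) ^ 2 : ℝ) * p.2) * phiT k ((n : ℝ) ^ 2) p := by
      rw [← integral_sub (mul_phiT_int k _ (continuous_ft _ a b))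
        (mul_phiT_int k _ (continuous_ft _ a b)), ← integral_const_mul]
      congr 1
      funext p
      rw [← sub_mul, ft_flip, tm_eq a b n hna]
      ring
    have e2 := congrArg norm e1
    rw [norm_mul, norm_mul, norm_real, Real.norm_eq_abs, abs_cf_flip, Complex.norm_exp] at e2
    have e3 : (-I * (((n : ℝ) ^ 2 : ℝ) : ℂ) * (b : ℂ)).re = 0 := by
      rw [mul_assoc, ← ofReal_mul]
      generalize ((n : ℝ) ^ 2 * b : ℝ) = s
      simp
    rw [e3, Real.exp_zero, mul_one] at e2
    rw [← e2]
    exact (norm_sub_le _ _).trans (by linarith)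
  have hB := hC ((n : ℝ) ^ 2) (by positivity)
  set G := (8 : ℝ) ^ n * Real.exp (-q * (n : ℝ) ^ 2) with hG
  set x := Real.exp (-(n : ℝ) ^ 2 * (r ^ 2 / 4)) with hx
  set y := Real.exp (-q * (n : ℝ) ^ 2) with hy
  have hxy : Real.exp (-(n : ℝ) ^ 2 * r ^ 2) = x * y := by
    rw [hx, hy, ← Real.exp_add]; congr 1; rw [hq]; ring
  rw [hxy] at key hB
  have hx0 : 0 < x := Real.exp_pos _
  have hy0 : 0 < y := Real.exp_pos _
  have s1 : (1 / 2 : ℝ) ^ n * (Real.pi * (r * x - C * (x * y))) ≤ 2 * (N * (n : ℝ) ^ 2 * (x * y)) :=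
    le_trans (by gcongr) key
  have s2 : (1 / 2 : ℝ) ^ n * (Real.pi * (r - C * y)) ≤ 2 * (N * (n : ℝ) ^ 2 * y) := by
    by_contra hcon
    push Not at hcon
    have := mul_lt_mul_of_pos_right hcon hx0
    nlinarith
  have s3 : Real.pi * (r - C * y) ≤ 2 ^ n * (2 * (N * (n : ℝ) ^ 2 * y)) := by
    have := mul_le_mul_of_nonneg_left s2 (show (0 : ℝ) ≤ 2 ^ n by positivity)
    rwa [← mul_assoc, ← mul_pow, show (2 : ℝ) * (1 / 2) = 1 by norm_num, one_pow, one_mul] at this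
  have n4 : (n : ℝ) ^ 2 ≤ 4 ^ n := by
    have : n ≤ 2 ^ n := Nat.lt_two_pow_self.le
    have h' : (n : ℝ) ≤ 2 ^ n := by exact_mod_cast this
    calc (n : ℝ) ^ 2 ≤ (2 ^ n) ^ 2 := by gcongr
      _ = 4 ^ n := by rw [← pow_mul, mul_comm, pow_mul]; norm_num
  have s4 : 2 ^ n * (2 * (N * (n : ℝ) ^ 2 * y)) ≤ 2 * N * G := by
    calc _ ≤ (2 : ℝ) ^ n * (2 * (N * 4 ^ n * y)) := by gcongr
      _ = 2 * N * ((2 * 4) ^ n * y) := by rw [mul_pow]; ring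
      _ = _ := by rw [hG]; norm_num
  have s5 : Real.pi * (C * y) ≤ Real.pi * |C| * G := by
    have : (1 : ℝ) ≤ 8 ^ n := one_le_pow₀ (by norm_num)
    have : y ≤ G := by rw [hG]; nlinarith
    rw [mul_assoc]
    gcongr
    exact le_abs_self C
  nlinarith

lemma exists_c : ∃ c : ℕ → Bool, ∀ (j : ℕ) (b : ℚ) (k N : ℕ),
    c ∉ ES (TopologicalSpace.denseSeq ℂ j) b k N := by
  by_contra hcon
  push Not at hcon
  have hU : (⋃ i : ℕ × ℚ × ℕ × ℕ,
      ES (TopologicalSpace.denseSeq ℂ i.1) i.2.1 i.2.2.1 i.2.2.2) = Set.univ := by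
    ext c
    obtain ⟨j, b, k, N, h⟩ := hcon c
    simp only [Set.mem_iUnion, Set.mem_univ, iff_true]
    exact ⟨(j, b, k, N), h⟩
  obtain ⟨i, hi⟩ := nonempty_interior_of_iUnion_of_closed
    (fun i : ℕ × ℚ × ℕ × ℕ => isClosed_ES (TopologicalSpace.denseSeq ℂ i.1) i.2.1 i.2.2.1 i.2.2.2) hU
  exact ES_interior _ _ _ _ hi


def omg (c : ℕ → Bool) (p : ℂ × ℂ) : ℂ := Om c (p.1, p.2.re, p.2.im - normSq p.1)

lemma contDiff_omg (c : ℕ → Bool) : ContDiff ℝ (⊤ : ℕ∞) (omg c) := by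
  unfold omg
  have h1 : ContDiff ℝ (⊤ : ℕ∞) fun p : ℂ × ℂ => p.2.re := reCLM.contDiff.comp contDiff_snd
  have h2 : ContDiff ℝ (⊤ : ℕ∞) fun p : ℂ × ℂ => p.2.im := imCLM.contDiff.comp contDiff_snd
  have h3 : ContDiff ℝ (⊤ : ℕ∞) fun p : ℂ × ℂ => normSq p.1 := contDiff_normSq.comp contDiff_fst
  exact (contDiff_Om c).comp (contDiff_fst.prodMk (h1.prodMk (h2.sub h3)))

lemma contDiff_f (c : ℕ → Bool) : ContDiff ℝ (⊤ : ℕ∞) (fun p : ℂ × ℝ => Om c (p.1, p.2, 0)) :=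
  (contDiff_Om c).comp (contDiff_fst.prodMk (contDiff_snd.prodMk contDiff_const))

lemma term_hol (a z w : ℂ) (l : ℝ) (hl : 0 ≤ l) (h : w.im ≤ normSq z) :
    term a l (z, w.re, w.im - normSq z) =
      cexp (-I * l * (w + (2 * a.re * z.im - 2 * a.im * z.re : ℝ) - I * (normSq z : ℝ))) := by
  unfold term
  rw [tt_apply, ell_apply, rhoC, rho_of_nonpos (mul_nonpos_of_nonneg_of_nonpos hl (by linarith)),
    ofReal_exp, ← Complex.exp_add]
  congr 1
  generalize 2 * a.re * z.im - 2 * a.im * z.re = s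
  generalize normSq z = N
  conv_rhs => rw [← re_add_im w]
  push_cast
  linear_combination (l * (w.im - N) : ℂ) * I_sq

lemma term_le_one (a z w : ℂ) (l : ℝ) (hl : 0 ≤ l) (h : w.im ≤ normSq z) :
    ‖term a l (z, w.re, w.im - normSq z)‖ ≤ 1 := by
  unfold term
  rw [tt_apply, rhoC, rho_of_nonpos (mul_nonpos_of_nonneg_of_nonpos hl (by linarith)),
    norm_mul, Complex.norm_exp, norm_real, Real.norm_eq_abs, Real.abs_exp]
  generalize (l * ell a (z, w.re, w.im - normSq z) : ℝ) = s
  have : (-I * (s : ℂ)).re = 0 := by simp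
  rw [this, Real.exp_zero, one_mul, Real.exp_le_one_iff]
  exact mul_nonpos_of_nonneg_of_nonpos hl (by linarith)

lemma omg_hol (c : ℕ → Bool) (z : ℂ) :
    DifferentiableOn ℂ (fun w => omg c (z, w)) {w : ℂ | w.im < normSq z} := by
  have ho : IsOpen {w : ℂ | w.im < normSq z} := isOpen_lt continuous_im continuous_const
  refine differentiableOn_tsum_of_summable_norm
    (F := fun n w => cf c n • term (seqA n) ((n : ℝ) ^ 2) (z, w.re, w.im - normSq z))
    summable_geometric_two (fun n => ?_) ho (fun n w hw => ?_)
  · have : DifferentiableOn ℂ (fun w : ℂ => cf c n • cexp (-I * ((n : ℝ) ^ 2 : ℝ) *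
      (w + (2 * (seqA n).re * z.im - 2 * (seqA n).im * z.re : ℝ) - I * (normSq z : ℝ))))
        {w : ℂ | w.im < normSq z} := by fun_prop
    refine this.congr fun w hw => ?_
    rw [term_hol _ _ _ _ (by positivity) (le_of_lt hw)]
  · rw [norm_smul, Real.norm_eq_abs, abs_of_nonneg (cf_nonneg _ _)]
    have h1 := term_le_one (seqA n) z w ((n : ℝ) ^ 2) (by positivity) (le_of_lt hw)
    calc _ ≤ (1 / 2 : ℝ) ^ n * 1 := by
          gcongr
          exact cf_le c n
      _ = _ := mul_one _

lemma dbar2_omg (c : ℕ → Bool) (p : ℂ × ℂ) (hp : p ∈ HeisMinus) : dbar2 (omg c) p = 0 := by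
  have ho : IsOpen {w : ℂ | w.im < normSq p.1} := isOpen_lt continuous_im continuous_const
  have h1 := ((omg_hol c p.1).differentiableAt (ho.mem_nhds hp)).hasDerivAt.hasFDerivAt.restrictScalars ℝ
  have h2 : HasFDerivAt (omg c) (fderiv ℝ (omg c) p) (p.1, p.2) :=
    ((contDiff_omg c).differentiable (by simp)).differentiableAt.hasFDerivAt
  have h3 := h2.comp p.2 (hasFDerivAt_prodMk_right p.1 p.2)
  have h4 := h3.unique h1
  unfold dbar2
  have e1 := congrArg (fun L : ℂ →L[ℝ] ℂ => L 1) h4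
  have e2 := congrArg (fun L : ℂ →L[ℝ] ℂ => L I) h4
  simp at e1 e2
  rw [e1, e2]
  linear_combination (deriv (fun w => omg c (p.1, w)) p.2 / 2) * I_sq

lemma Heis_sub : Heis ⊆ closure HeisMinus := by
  intro p hp
  have hp' : p.2.im = normSq p.1 := hp
  rw [mem_closure_iff_seq_limit]
  refine ⟨fun n => (p.1, p.2 - I * ((1 / ((n : ℝ) + 1) : ℝ) : ℂ)), fun n => ?_, ?_⟩
  · show (p.2 - I * ((1 / ((n : ℝ) + 1) : ℝ) : ℂ)).im < normSq p.1
    have : (0 : ℝ) < 1 / ((n : ℝ) + 1) := by positivity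
    rw [sub_im, I_mul_im, ofReal_re]
    linarith
  · have h : Filter.Tendsto (fun n : ℕ => ((1 / ((n : ℝ) + 1) : ℝ) : ℂ)) Filter.atTop (𝓝 ((0 : ℝ) : ℂ)) :=
      (continuous_ofReal.tendsto 0).comp tendsto_one_div_add_atTop_nhds_zero_nat
    have h2 := (tendsto_const_nhds (x := p.2)).sub (h.const_mul I)
    simp only [ofReal_zero, mul_zero, sub_zero] at h2
    exact (tendsto_const_nhds (x := p.1)).prodMk_nhds h2

def Psi (a : ℂ) (b : ℝ) (p : ℂ × ℝ) : ℂ × ℂ :=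
  (p.1 + a, zeta p + (b + I * (normSq a : ℝ)) + 2 * I * (starRingEnd ℂ a) * p.1)

lemma Psi_Heis (a : ℂ) (b : ℝ) (p : ℂ × ℝ) : Psi a b p ∈ Heis := by
  show (Psi a b p).2.im = normSq (Psi a b p).1
  simp [Psi, zeta, normSq_apply]
  ring

lemma Psi_pb (a : ℂ) (b : ℝ) (p : ℂ × ℝ) :
    ((Psi a b p).1, (Psi a b p).2.re) = pb a b p := by
  simp only [Psi, pb, zeta, Prod.mk.injEq, true_and]
  simp
  ring

lemma contDiff_Psi (a : ℂ) (b : ℝ) : ContDiff ℝ 1 (Psi a b) := by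
  unfold Psi
  have h : ContDiff ℝ 1 zeta := contDiff_zeta
  fun_prop

lemma hasFDerivAt_Psi (a : ℂ) (b : ℝ) (p : ℂ × ℝ) :
    ∃ D : ℂ × ℝ →L[ℝ] ℂ × ℂ, HasFDerivAt (Psi a b) D p ∧
      D (1, 2 * p.1.im) = (1, 2 * I * (starRingEnd ℂ (Psi a b p).1)) ∧
      D (I, -2 * p.1.re) = (I, -2 * (starRingEnd ℂ (Psi a b p).1)) := by
  have h1 : HasFDerivAt (fun p : ℂ × ℝ => p.1) (ContinuousLinearMap.fst ℝ ℂ ℝ) p := hasFDerivAt_fst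
  have h2 := (h1.add_const a).prodMk
    (((hasFDerivAt_zeta p).add_const (b + I * (normSq a : ℝ))).add
      (h1.const_mul (2 * I * (starRingEnd ℂ a))))
  refine ⟨_, h2, ?_, ?_⟩
  · apply Prod.ext
    · simp
    · apply Complex.ext <;> simp [Psi] <;> ring
  · apply Prod.ext
    · simp
    · apply Complex.ext <;> simp [Psi] <;> ring


lemma selection (ζ₀ : ℂ × ℂ) (hζ : ζ₀ ∈ Heis) (V : Set (ℂ × ℂ)) (hV : V ∈ 𝓝 ζ₀) :
    ∃ (j : ℕ) (b : ℚ) (k : ℕ), ∀ p ∈ KK k, Psi (TopologicalSpace.denseSeq ℂ j) b p ∈ V := by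
  have hζ' : ζ₀.2.im = normSq ζ₀.1 := hζ
  let F : (ℂ × ℝ) × (ℂ × ℝ) → ℂ × ℂ := fun q => Psi q.1.1 q.1.2 q.2
  have hF : Continuous F := by
    have h1 : Continuous zeta := (contDiff_zeta (n := 0)).continuous
    have h2 := continuous_normSq
    have h3 := continuous_conj
    have h4 := continuous_ofReal
    show Continuous fun q : (ℂ × ℝ) × (ℂ × ℝ) => ((q.2.1 + q.1.1,
      zeta q.2 + (q.1.2 + I * (normSq q.1.1 : ℝ)) + 2 * I * (starRingEnd ℂ q.1.1) * q.2.1) : ℂ × ℂ)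
    fun_prop
  have hF0 : F ((ζ₀.1, ζ₀.2.re), (0, 0)) = ζ₀ := by
    simp only [F, Psi, zeta]
    apply Prod.ext
    · simp
    · apply Complex.ext <;> simp [hζ']
  have hV' : F ⁻¹' V ∈ 𝓝 ((ζ₀.1, ζ₀.2.re), ((0 : ℂ), (0 : ℝ))) :=
    hF.continuousAt.preimage_mem_nhds (by rw [hF0]; exact hV)
  obtain ⟨ε, hε, hball⟩ := Metric.mem_nhds_iff.1 hV'
  obtain ⟨j, hj⟩ := (TopologicalSpace.denseRange_denseSeq ℂ).exists_dist_lt ζ₀.1 hε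
  obtain ⟨b, hb1, hb2⟩ := exists_rat_btwn (show ζ₀.2.re < ζ₀.2.re + ε by linarith)
  obtain ⟨k, hk⟩ := exists_nat_one_div_lt (show 0 < min (ε / 2) (ε ^ 2 / 2) by positivity)
  refine ⟨j, b, k, fun p hp => ?_⟩
  have hr : rad k ≤ 1 / ((k : ℝ) + 1) := by
    unfold rad; gcongr; norm_num
  obtain ⟨hk1, hk2⟩ := lt_min_iff.1 (hr.trans_lt hk)
  obtain ⟨hp1, hp2⟩ := hp
  have : ((TopologicalSpace.denseSeq ℂ j, (b : ℝ)), p) ∈ F ⁻¹' V := by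
    apply hball
    rw [Metric.mem_ball, Prod.dist_eq, Prod.dist_eq, Prod.dist_eq, max_lt_iff, max_lt_iff, max_lt_iff]
    refine ⟨⟨by rw [dist_comm]; exact hj, ?_⟩, ?_, ?_⟩
    · simp only
      rw [Real.dist_eq, abs_lt]; constructor <;> linarith
    · simp only
      rw [dist_zero_right]
      rw [normSq_eq_norm_sq] at hp2
      exact lt_of_pow_lt_pow_left₀ 2 hε.le (by linarith)
    · simp only
      rw [dist_zero_right, Real.norm_eq_abs]; linarith
  exact this

lemma nonsolv (c : ℕ → Bool) (hc : ∀ (j : ℕ) (b : ℚ) (k N : ℕ),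
    c ∉ ES (TopologicalSpace.denseSeq ℂ j) b k N) (ζ₀ : ℂ × ℂ) (hζ : ζ₀ ∈ Heis)
    (U₀ : Set (ℂ × ℂ)) (hU : RelOpenIn2 U₀ (closure HeisMinus)) (h0 : ζ₀ ∈ U₀) (A : ℂ × ℂ → ℂ)
    (hA : ContDiffOn ℝ 1 A (Heis ∩ U₀)) (hA0 : A ζ₀ ≠ 0)
    (hLA : ∀ p ∈ Heis ∩ U₀, tangCR (Heis ∩ U₀) A p = A p * Om c (p.1, p.2.re, 0)) : False := by
  obtain ⟨-, V₀, hV₀, rfl⟩ := hU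
  set S := Heis ∩ (V₀ ∩ closure HeisMinus) with hS
  have hSV : ∀ p, p ∈ Heis → p ∈ V₀ → p ∈ S := fun p h h' => ⟨h, h', Heis_sub h⟩
  have hcont : ContinuousWithinAt A S ζ₀ := hA.continuousOn ζ₀ ⟨hζ, h0⟩
  set T : Set ℂ := {w | w / A ζ₀ ∈ slitPlane} with hT
  have hTo : IsOpen T := isOpen_slitPlane.preimage (continuous_id.div_const (A ζ₀))
  have hTm : A ζ₀ ∈ T := by
    show A ζ₀ / A ζ₀ ∈ slitPlane
    rw [div_self hA0]; exact one_mem_slitPlane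
  have hpre : A ⁻¹' T ∈ 𝓝[S] ζ₀ := hcont.preimage_mem_nhdsWithin (hTo.mem_nhds hTm)
  obtain ⟨V1, hV1, hV1'⟩ := mem_nhdsWithin_iff_exists_mem_nhds_inter.1 hpre
  obtain ⟨j, b, k, hsel⟩ := selection ζ₀ hζ (V1 ∩ V₀) (Filter.inter_mem hV1 (hV₀.mem_nhds h0.1))
  set a := TopologicalSpace.denseSeq ℂ j with ha
  have hPc := contDiff_Psi a b
  set W0 : Set (ℂ × ℝ) := Psi a b ⁻¹' V₀ with hW0
  have hW0o : IsOpen W0 := hV₀.preimage hPc.continuous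
  have hmaps : Set.MapsTo (Psi a b) W0 S := fun p hp => hSV _ (Psi_Heis a b p) hp
  have hAP : ContDiffOn ℝ 1 (A ∘ Psi a b) W0 := hA.comp hPc.contDiffOn hmaps
  set W : Set (ℂ × ℝ) := W0 ∩ (A ∘ Psi a b) ⁻¹' T with hW
  have hWo : IsOpen W := hAP.continuousOn.isOpen_inter_preimage hW0o hTo
  have hKW : KK k ⊆ W := by
    intro p hp
    obtain ⟨h1, h2⟩ := hsel p hp
    exact ⟨h2, hV1' ⟨h1, hSV _ (Psi_Heis a b p) h2⟩⟩
  set u : ℂ × ℝ → ℂ := fun p => Complex.log (A (Psi a b p) / A ζ₀) with hu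
  have huC : ContDiffOn ℝ 1 u W := by
    intro p hp
    have h1 : ContDiffAt ℝ 1 Complex.log (A (Psi a b p) / A ζ₀) :=
      (contDiffAt_log hp.2).restrict_scalars ℝ
    have h2 : ContDiffWithinAt ℝ 1 (fun p => A (Psi a b p) / A ζ₀) W p :=
      ((hAP p hp.1).mono Set.inter_subset_left).div_const _
    exact h1.comp_contDiffWithinAt p h2
  have hLu : ∀ p ∈ W, Lop u p = ft c a b p := by
    intro p hp
    have hq : Psi a b p ∈ S := hmaps hp.1
    have hd : HasFDerivWithinAt A (fderivWithin ℝ A S (Psi a b p)) S (Psi a b p) :=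
      (hA.differentiableOn one_ne_zero _ hq).hasFDerivWithinAt
    obtain ⟨D, hD, hD1, hD2⟩ := hasFDerivAt_Psi a b p
    have hev : ∀ᶠ p' in 𝓝 p, Psi a b p' ∈ S := by
      filter_upwards [hW0o.mem_nhds hp.1] with p' hp'
      exact hmaps hp'
    have h1 := hd.comp_hasFDerivAt p hD hev
    have h2 : HasFDerivAt (fun p => A (Psi a b p) / A ζ₀) _ p := h1.mul_const (A ζ₀)⁻¹
    have h3 := (Complex.hasStrictDerivAt_log hp.2).hasDerivAt.complexToReal_fderiv
    have h4 := HasFDerivAt.comp (g := Complex.log) p h3 h2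
    have hue : u = Complex.log ∘ fun p => A (Psi a b p) / A ζ₀ := rfl
    have hne : A (Psi a b p) ≠ 0 := by
      intro h
      have h5 : A (Psi a b p) / A ζ₀ ∈ slitPlane := hp.2
      rw [h, zero_div] at h5
      exact zero_notMem_slitPlane h5
    have hL := hLA _ hq
    unfold tangCR at hL
    have hft : ft c a b p = Om c ((Psi a b p).1, (Psi a b p).2.re, 0) := by
      unfold ft; rw [← Psi_pb]
    rw [hft]
    unfold Lop
    rw [hue, h4.fderiv]
    rw [neg_mul, neg_mul] at hD2
    simp [hD1, hD2]
    simp at hL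
    field_simp
    linear_combination 2 * hL
  obtain ⟨N, hN⟩ := lemA k W hWo hKW u huC (ft c a b) (continuous_ft c a b) hLu
  exact hc j b k N fun n => hN _ (by positivity)

/-!
STATEMENT 8 (Proposition 2.9): There is a smooth function `f(z₁,x₂)` such that for every
`ζ₀ ∈ H` and every relatively open subset `U` of `closure H⁻` containing `ζ₀`, the
`(0,1)`-form `f(z₁,x₂) dz̄₁` on `H` extends to a `∂̄`-closed smooth `(0,1)`-form
`ω = ω₁ dz̄₁ + ω₂ dz̄₂` on `U`, for which the (tangential) equation `∂̄A = Aω` admits no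
`C¹` solution `A` with `A(ζ₀) ≠ 0` on `H ∩ U₀`, for any neighborhood `U₀` of `ζ₀` in
`closure H⁻`.  (The integrability theorem fails with only one negative Levi eigenvalue.)
-/
theorem statement_8 :
    ∃ f : ℂ × ℝ → ℂ, ContDiff ℝ (⊤ : ℕ∞) f ∧
      ∀ ζ₀ ∈ Heis, ∀ U : Set (ℂ × ℂ), RelOpenIn2 U (closure HeisMinus) → ζ₀ ∈ U →
        ∃ ω₁ ω₂ : ℂ × ℂ → ℂ,
          -- ω is a smooth (0,1) form on U
          ContDiffOn ℝ (⊤ : ℕ∞) ω₁ U ∧ ContDiffOn ℝ (⊤ : ℕ∞) ω₂ U ∧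
          -- ∂̄-closed (on the open part U ∖ H = U ∩ H⁻)
          (∀ p ∈ U ∩ HeisMinus, dbar1 ω₂ p = dbar2 ω₁ p) ∧
          -- ω extends the form f dz̄₁ on H: its tangential part along
          -- L = ∂/∂z̄₁ - 2i z₁ ∂/∂z̄₂ agrees with that of f dz̄₁
          (∀ p ∈ Heis ∩ U, ω₁ p - 2 * Complex.I * p.1 * ω₂ p = f (p.1, p.2.re)) ∧
          -- and the equation ∂̄_b A = A ⟨ω, L⟩ = A f has no C¹ solution with A(ζ₀) ≠ 0
          (∀ U₀ : Set (ℂ × ℂ), RelOpenIn2 U₀ (closure HeisMinus) → ζ₀ ∈ U₀ →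
            ¬ ∃ A : ℂ × ℂ → ℂ, ContDiffOn ℝ 1 A (Heis ∩ U₀) ∧ A ζ₀ ≠ 0 ∧
              ∀ p ∈ Heis ∩ U₀, tangCR (Heis ∩ U₀) A p = A p * f (p.1, p.2.re)) := by
  obtain ⟨c, hc⟩ := exists_c
  refine ⟨fun p => Om c (p.1, p.2, 0), contDiff_f c, fun ζ₀ hζ U _ _ =>
    ⟨omg c, fun _ => 0, (contDiff_omg c).contDiffOn, contDiff_const.contDiffOn, ?_, ?_, ?_⟩⟩
  · intro p hp
    rw [dbar2_omg c p hp.2]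
    simp [dbar1]
  · intro p hp
    have h : p.2.im = normSq p.1 := hp.1
    simp [omg, h]
  · rintro U₀ hU h0 ⟨A, hA, hA0, hLA⟩
    exact nonsolv c hc ζ₀ hζ U₀ hU h0 A hA hA0 hLA
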